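/- For every β with 0 < β < √2/2 one has F₂(β) − F₂(√2−β) > 0, i.e., F₂(β) > F₂(√2−β). -/

import Mathlib

open Real

/-- F₂(β) = 4β·log β + 2/β + 2(1−β)·log|1−β| − 2(1+β)·log(1+β). -/
noncomputable def F2 (β : ℝ) : ℝ :=
  4 * β * Real.log β + 2 / β + 2 * (1 - β) * Real.log |1 - β|
    - 2 * (1 + β) * Real.log (1 + β)

lemma hasDerivAt_affine_mul_log {a b x : ℝ} (h : a + b * x ≠ 0) :
    HasDerivAt (fun y => (a + b * y) * log (a + b * y)) (b * log (a + b * x) + b) x := by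
  have h₁ : HasDerivAt (fun y : ℝ => a + b * y) b x := by
    simpa using ((hasDerivAt_id x).const_mul b).const_add a
  refine (h₁.mul (h₁.log h)).congr_deriv ?_
  field_simp

/-- The part of `F2` that is smooth on the positive half-line. -/
noncomputable def F2Smooth (x : ℝ) : ℝ :=
  4 * x * log x + 2 / x - 2 * (1 + x) * log (1 + x)

lemma F2_eq_smooth_add (x : ℝ) : F2 x = F2Smooth x + 2 * ((1 - x) * log (1 - x)) := by
  simp only [F2, F2Smooth, log_abs]
  ring

lemma hasDerivAt_F2Smooth {x : ℝ} (hx : 0 < x) :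
    HasDerivAt F2Smooth (4 * log x - 2 / x ^ 2 - 2 * log (1 + x) + 2) x := by
  have h₁ := hasDerivAt_affine_mul_log (a := 0) (b := 1) (x := x) (by simpa using hx.ne')
  have h₂ := hasDerivAt_affine_mul_log (a := 1) (b := 1) (x := x) (by positivity)
  have h₃ := (hasDerivAt_inv hx.ne').const_mul 2
  refine ((((h₁.const_mul 4).add h₃).sub (h₂.const_mul 2)).congr_deriv ?_).congr_of_eventuallyEq
    (Filter.Eventually.of_forall fun y => ?_)
  · simp only [zero_add, one_mul]
    ring
  · simp only [F2Smooth, Pi.add_apply, Pi.sub_apply, zero_add, one_mul]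
    ring

lemma hasDerivAt_F2 {x : ℝ} (hx : 0 < x) (hx₁ : x < 1) :
    HasDerivAt F2 (4 * log x - 2 / x ^ 2 - 2 * log (1 + x) - 2 * log (1 - x)) x := by
  have h₁ := hasDerivAt_affine_mul_log (a := 1) (b := -1) (x := x) (by linarith)
  refine (((hasDerivAt_F2Smooth hx).add (h₁.const_mul 2)).congr_deriv ?_).congr_of_eventuallyEq
    (Filter.Eventually.of_forall fun y => ?_)
  · simp only [neg_one_mul, ← sub_eq_add_neg]
    ring
  · simp only [F2_eq_smooth_add, Pi.add_apply, neg_one_mul, ← sub_eq_add_neg]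

lemma HasDerivAt.comp_reflection {f : ℝ → ℝ} {f' c x : ℝ} (h : HasDerivAt f f' (c - x)) :
    HasDerivAt (fun y => f (c - y)) (-f') x := by
  simpa using HasDerivAt.comp_const_sub c x h

lemma deriv_F2_add_reflection_le {x y : ℝ} (hx : 1 / 2 ≤ x) (hxy : x ≤ y) (hs : x + y = √2) :
    (4 * log x - 2 / x ^ 2 - 2 * log (1 + x) - 2 * log (1 - x)) +
      (4 * log y - 2 / y ^ 2 - 2 * log (1 + y) - 2 * log (1 - y)) ≤ -8 := by
  have s0 : √2 ^ 2 = 2 := sq_sqrt (by norm_num)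
  have s1 : (1.414 : ℝ) < √2 := lt_sqrt_of_sq_lt (by norm_num)
  have s2 : √2 < 1.415 := by
    rw [sqrt_lt' (by norm_num)]
    norm_num
  have hx0 : 0 < x := by linarith
  have hy0 : 0 < y := by linarith
  have hy1 : y < 1 := by linarith
  have hsum : x ^ 2 + y ^ 2 = 2 - 2 * (x * y) := by
    rw [← hs] at s0
    linarith
  set p := x * y with hp
  have hp0 : 0 < p := mul_pos hx0 hy0
  have hp1 : p ≤ 1 / 2 := by nlinarith [sq_nonneg (x - y)]
  have hp2 : 0.457 ≤ p := by nlinarith [mul_nonneg (sub_nonneg.2 hx) (by linarith : 0 ≤ y - 1 / 2)]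
  set q := p ^ 2 + 2 * p - 1 with hq
  have hq0 : 0 < q := by nlinarith
  have hqe : q = (1 + x) * (1 - x) * ((1 + y) * (1 - y)) := by
    rw [hq, hp]
    linear_combination hsum
  have hlq : log q = log (1 + x) + log (1 - x) + (log (1 + y) + log (1 - y)) := by
    have : 0 < 1 - x := by linarith
    have : 0 < 1 - y := by linarith
    rw [hqe, log_mul, log_mul, log_mul] <;> positivity
  have hlp : log p = log x + log y := log_mul hx0.ne' hy0.ne'
  have hl : 2 * log p - log q ≤ p ^ 2 / q - 1 := by
    have := log_le_sub_one_of_pos (div_pos (pow_pos hp0 2) hq0)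
    rwa [log_div (by positivity) hq0.ne', log_pow, Nat.cast_ofNat] at this
  have hinv : 2 / x ^ 2 + 2 / y ^ 2 = 2 * ((2 - 2 * p) / p ^ 2) := by
    rw [← hsum, hp]
    field_simp
    ring
  have hmain : p ^ 2 / q - 1 - (2 - 2 * p) / p ^ 2 ≤ -4 := by
    have hle : p ^ 2 ≤ 2 * (1 + p) * q := by nlinarith
    have : p ^ 2 / q - 1 - (2 - 2 * p) / p ^ 2 + 4
        = (1 - 2 * p) * (p ^ 2 - 2 * (1 + p) * q) / (q * p ^ 2) := by
      field_simp
      rw [hq]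
      ring
    have : (1 - 2 * p) * (p ^ 2 - 2 * (1 + p) * q) / (q * p ^ 2) ≤ 0 :=
      div_nonpos_of_nonpos_of_nonneg
        (mul_nonpos_of_nonneg_of_nonpos (by linarith) (by linarith)) (by positivity)
    linarith
  linarith

lemma le_F2_sub_reflection {β : ℝ} (h0 : 1 / 2 ≤ β) (h1 : β ≤ √2 / 2) :
    8 * (√2 / 2 - β) ≤ F2 β - F2 (√2 - β) := by
  have s2 : √2 < 1.415 := by
    rw [sqrt_lt' (by norm_num)]
    norm_num
  have hd : ∀ x ∈ Set.Icc (1 / 2) (√2 / 2), HasDerivAt (fun x => F2 x - F2 (√2 - x) + 8 * x)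
      ((4 * log x - 2 / x ^ 2 - 2 * log (1 + x) - 2 * log (1 - x)) -
        -(4 * log (√2 - x) - 2 / (√2 - x) ^ 2 - 2 * log (1 + (√2 - x))
          - 2 * log (1 - (√2 - x))) + 8 * 1) x := fun x ⟨hx, hx'⟩ =>
    ((hasDerivAt_F2 (by linarith) (by linarith)).sub
      (hasDerivAt_F2 (by linarith) (by linarith)).comp_reflection).add
      ((hasDerivAt_id x).const_mul 8)
  have hanti := antitoneOn_of_hasDerivWithinAt_nonpos (convex_Icc (1 / 2) (√2 / 2))
    (fun x hx => (hd x hx).continuousAt.continuousWithinAt)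
    (fun x hx => (hd x (interior_subset hx)).hasDerivWithinAt)
    (fun x hx => by
      obtain ⟨hx, hx'⟩ := interior_subset hx
      have := deriv_F2_add_reflection_le (y := √2 - x) hx (by linarith) (by ring)
      linarith)
  have := hanti ⟨h0, h1⟩ ⟨h0.trans h1, le_rfl⟩ h1
  simp only [show √2 - √2 / 2 = √2 / 2 by ring] at this
  linarith

lemma F2_sub_smooth_reflection_anti {β : ℝ} (h0 : 0 < β) (h1 : β ≤ 1 / 2) :
    F2 (1 / 2) - F2Smooth (√2 - 1 / 2) ≤ F2 β - F2Smooth (√2 - β) := by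
  have s1 : (1.414 : ℝ) < √2 := lt_sqrt_of_sq_lt (by norm_num)
  have s2 : √2 < 1.415 := by
    rw [sqrt_lt' (by norm_num)]
    norm_num
  have hd : ∀ x ∈ Set.Ioc (0 : ℝ) (1 / 2), HasDerivAt (fun x => F2 x - F2Smooth (√2 - x))
      ((4 * log x - 2 / x ^ 2 - 2 * log (1 + x) - 2 * log (1 - x)) -
        -(4 * log (√2 - x) - 2 / (√2 - x) ^ 2 - 2 * log (1 + (√2 - x)) + 2)) x := fun x ⟨hx, hx'⟩ =>
    (hasDerivAt_F2 (by linarith) (by linarith)).sub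
      (hasDerivAt_F2Smooth (by linarith)).comp_reflection
  refine antitoneOn_of_hasDerivWithinAt_nonpos (convex_Ioc 0 (1 / 2))
    (fun x hx => (hd x hx).continuousAt.continuousWithinAt)
    (fun x hx => (hd x (interior_subset hx)).hasDerivWithinAt)
    (fun x hx => ?_) ⟨h0, h1⟩ ⟨by norm_num, le_rfl⟩ h1
  obtain ⟨hx, hx'⟩ := interior_subset hx
  have hlog : 2 * log x ≤ log (1 + x) + log (1 - x) := by
    have := log_le_log (show 0 < x ^ 2 by positivity)
      (show x ^ 2 ≤ (1 + x) * (1 - x) by nlinarith)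
    rwa [log_pow, Nat.cast_ofNat, log_mul (by linarith) (by linarith)] at this
  have hlog' : 2 * log (√2 - x) ≤ log (1 + (√2 - x)) := by
    have h_pos : 0 < √2 - x := by linarith
    have := log_le_log (pow_pos h_pos 2) (show (√2 - x) ^ 2 ≤ 1 + (√2 - x) by nlinarith)
    rwa [log_pow, Nat.cast_ofNat] at this
  have hinv : 2 ≤ 2 / x ^ 2 := by
    rw [le_div_iff₀ (by positivity)]
    nlinarith
  have hinv' : 0 ≤ 2 / (√2 - x) ^ 2 := by positivity
  linarith

lemma le_mul_log {x c : ℝ} (hx : 0 < x) (hc : 0 < c) : x - 1 / c - x * log c ≤ x * log x := by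
  have h := log_le_sub_one_of_pos (show 0 < 1 / (c * x) by positivity)
  rw [one_div, log_inv, log_mul hc.ne' hx.ne'] at h
  have := mul_le_mul_of_nonneg_left h hx.le
  have e : x * ((c * x)⁻¹ - 1) = 1 / c - x := by
    field_simp
  linarith

theorem F2_gt_reflection (β : ℝ) (h0 : 0 < β) (h1 : β < Real.sqrt 2 / 2) :
    F2 β > F2 (Real.sqrt 2 - β) := by
  have s1 : (1.414 : ℝ) < √2 := lt_sqrt_of_sq_lt (by norm_num)
  have s2 : √2 < 1.415 := by
    rw [sqrt_lt' (by norm_num)]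
    norm_num
  rcases le_total (1 / 2) β with h | h
  · linarith [le_F2_sub_reflection h h1.le]
  have hA := le_F2_sub_reflection (β := 1 / 2) le_rfl (by linarith)
  have hB := F2_sub_smooth_reflection_anti h0 h
  rw [F2_eq_smooth_add (√2 - 1 / 2)] at hA
  rw [F2_eq_smooth_add (√2 - β)]
  have hlog := log_two_lt_d9
  have hC : -0.57 ≤ (1 - (√2 - 1 / 2)) * log (1 - (√2 - 1 / 2)) * 2 := by
    have := le_mul_log (x := 1 - (√2 - 1 / 2)) (c := 4) (by linarith) (by norm_num)
    rw [show (4 : ℝ) = 2 ^ 2 by norm_num, log_pow] at this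
    push_cast at this
    nlinarith
  have hD : (1 - (√2 - β)) * log (1 - (√2 - β)) ≤ 1 / 2 := by
    rcases le_or_gt (√2 - β) 1 with hγ | hγ
    · linarith [mul_nonpos_of_nonneg_of_nonpos (sub_nonneg.2 hγ)
        (log_nonpos (sub_nonneg.2 hγ) (by linarith))]
    · have := le_mul_log (x := √2 - β - 1) (c := 2) (by linarith) (by norm_num)
      rw [← log_neg_eq_log, neg_sub]
      nlinarith
  linarith
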